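/- arXiv:0810.0427 — 2 statements merged into one kernel-verified Lean document; each statement's English description precedes it below -/
import Mathlib

section
/- For every natural number n ≥ 1, there exists a bijection φ from the set F_n of rooted labeled forests on n vertices onto the set PF_n of parking functions of length n such that for every forest F ∈ F_n, the type of inversions of F equals the type of jumps of φ(F) (i.e., for every i with 0 ≤ i ≤ n, the number of vertices v of F with inv(F:v) = i equals the number of cars c with jump(φ(F):c) = i), and the number of trees of F equals the number of critical cars of φ(F). -/
/-!  Parking functions and the parking algorithm. -/

/-- Parking algorithm: cars `0, 1, ..., n-1` (in Lean's 0-based indexing of `Fin n`,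
representing cars `1, ..., n`) arrive in order; car `i` drives to its favorite
(1-indexed) space `p i` and parks in the first space `s ≥ p i` not occupied by an
earlier car.  `PA p i` is the space where car `i` actually parks. -/
noncomputable def PA {n : ℕ} (p : Fin n → ℕ) (i : Fin n) : ℕ :=
  sInf {s : ℕ | p i ≤ s ∧ ∀ j : Fin n, j < i → PA p j ≠ s}
termination_by i.val
decreasing_by exact ‹_ < _›

/-- `p` is a parking function of length `n`: every favorite space is in `{1, ..., n}`
and every car ends up parked in a space `≤ n`. -/
def IsParkingFunction {n : ℕ} (p : Fin n → ℕ) : Prop :=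
  (∀ i, 1 ≤ p i ∧ p i ≤ n) ∧ ∀ i, PA p i ≤ n

/-- The set (type) `PF_n` of parking functions of length `n`. -/
def ParkingFunction (n : ℕ) : Type :=
  {p : Fin n → ℕ // IsParkingFunction p}

instance {n : ℕ} : Finite (ParkingFunction n) := by
  apply Finite.of_injective
    (fun P : ParkingFunction n => fun i => (⟨P.1 i, Nat.lt_succ_of_le (P.2.1 i).2⟩ : Fin (n+1)))
  intro P Q h
  apply Subtype.ext; funext i
  simpa [Fin.mk.injEq] using congrFun h i

noncomputable instance {n : ℕ} : Fintype (ParkingFunction n) := Fintype.ofFinite _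

/-- `jumpAt p c` is the number of jumps of car `c`, i.e. `q_c - p_c`. -/
noncomputable def jumpAt {n : ℕ} (p : Fin n → ℕ) (c : Fin n) : ℕ := PA p c - p c

/-- `jump p` is the total number of jumps. -/
noncomputable def jump {n : ℕ} (p : Fin n → ℕ) : ℕ := ∑ c, jumpAt p c

/-- `luckyCount p k` is the number of cars `c` with `jump(p : c) = k`. -/
noncomputable def luckyCount {n : ℕ} (p : Fin n → ℕ) (k : ℕ) : ℕ :=
  Set.ncard {c : Fin n | jumpAt p c = k}

/-- `lucky p` is the number of lucky cars, i.e. cars with no jumps. -/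
noncomputable def lucky {n : ℕ} (p : Fin n → ℕ) : ℕ :=
  Set.ncard {c : Fin n | jumpAt p c = 0}

/-- Car `c` is critical: immediately after car `c` is parked, there is no empty space
among the spaces strictly to the right of its space `q_c` within `{1, ..., n}`. -/
def IsCritical {n : ℕ} (p : Fin n → ℕ) (c : Fin n) : Prop :=
  ∀ s : ℕ, PA p c < s → s ≤ n → ∃ j : Fin n, j ≤ c ∧ PA p j = s

/-- `critic p` is the number of critical cars. -/
noncomputable def critic {n : ℕ} (p : Fin n → ℕ) : ℕ :=
  Set.ncard {c : Fin n | IsCritical p c}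

/-!  Rooted labeled forests, encoded by their parent function. -/

/-- A parent function `par : Fin n → Option (Fin n)` (where `par v = none` means that
`v` is a root) encodes a rooted labeled forest on `n` vertices iff it has no cycles. -/
def IsForest {n : ℕ} (par : Fin n → Option (Fin n)) : Prop :=
  ∀ v : Fin n, ¬ Relation.TransGen (fun a b => par a = some b) v v

/-- The set (type) `F_n` of rooted labeled forests on `n` vertices. -/
def Forest (n : ℕ) : Type := {par : Fin n → Option (Fin n) // IsForest par}

instance {n : ℕ} : Finite (Forest n) := Subtype.finite
noncomputable instance {n : ℕ} : Fintype (Forest n) := Fintype.ofFinite _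

/-- `x` is a descendant of `v`: `v` lies on the (unique) path from the root of `x`'s
component to `x`, i.e. the ancestor chain of `x` reaches `v`. -/
def Descendant {n : ℕ} (par : Fin n → Option (Fin n)) (v x : Fin n) : Prop :=
  Relation.ReflTransGen (fun a b => par a = some b) x v

/-- `forestInvAt F v = inv(F : v)`, the number of pairs `(v, x)` with `v > x` and
`x` a descendant of `v`. -/
noncomputable def forestInvAt {n : ℕ} (F : Forest n) (v : Fin n) : ℕ :=
  Set.ncard {x : Fin n | x < v ∧ Descendant F.1 v x}

/-- `forestInv F = inv(F)`, the total number of inversions of `F`. -/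
noncomputable def forestInv {n : ℕ} (F : Forest n) : ℕ := ∑ v, forestInvAt F v

/-- `forestLeadCount F k` is the number of vertices `v` with `inv(F : v) = k`. -/
noncomputable def forestLeadCount {n : ℕ} (F : Forest n) (k : ℕ) : ℕ :=
  Set.ncard {v : Fin n | forestInvAt F v = k}

/-- `forestLead F = lead(F)`, the number of leaders of `F`. -/
noncomputable def forestLead {n : ℕ} (F : Forest n) : ℕ :=
  Set.ncard {v : Fin n | forestInvAt F v = 0}

/-- `forestTree F = tree(F)`, the number of trees (connected components) of `F`,
i.e. the number of roots. -/
noncomputable def forestTree {n : ℕ} (F : Forest n) : ℕ :=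
  Set.ncard {v : Fin n | F.1 v = none}

/-! Bijections that transport a statistic. -/

/-- The statistics `s` and `t` have the same distribution: some bijection carries one to the
other. -/
def Equidistributed {X Y M : Type*} (s : X → M) (t : Y → M) : Prop :=
  ∃ e : X ≃ Y, ∀ x, t (e x) = s x

namespace Equidistributed

variable {X Y Z X' Y' U M I : Type*}

theorem symm {s : X → M} {t : Y → M} (h : Equidistributed s t) : Equidistributed t s := by
  obtain ⟨e, he⟩ := h
  exact ⟨e.symm, fun y => by rw [← he, Equiv.apply_symm_apply]⟩

theorem trans {s : X → M} {t : Y → M} {u : Z → M} (h : Equidistributed s t)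
    (h' : Equidistributed t u) : Equidistributed s u := by
  obtain ⟨e, he⟩ := h
  obtain ⟨e', he'⟩ := h'
  exact ⟨e.trans e', fun x => by simp [he', he]⟩

theorem prod {s : X → M} {t : Y → M} {s' : X' → M} {t' : Y' → M} (h : Equidistributed s t)
    (h' : Equidistributed s' t') (c : M → M → M) :
    Equidistributed (fun x : X × X' => c (s x.1) (s' x.2))
      (fun y : Y × Y' => c (t y.1) (t' y.2)) := by
  obtain ⟨e, he⟩ := h
  obtain ⟨e', he'⟩ := h'
  exact ⟨e.prodCongr e', fun x => by simp [he, he']⟩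

theorem of_fibers {s : X → M} {t : Y → M} (f : X → I) (g : Y → I)
    (h : ∀ i, Equidistributed (fun x : {x // f x = i} => s x) (fun y : {y // g y = i} => t y)) :
    Equidistributed s t := by
  choose e he using h
  refine ⟨(Equiv.sigmaFiberEquiv f).symm.trans
    ((Equiv.sigmaCongrRight e).trans (Equiv.sigmaFiberEquiv g)), fun x => ?_⟩
  exact he (f x) ⟨x, rfl⟩

theorem of_parametrization {P : X → Prop} (s : X → M) (u : U → X) (hu : Function.Injective u)
    (hP : ∀ x, P x ↔ ∃ a, u a = x) :
    Equidistributed (fun a => s (u a)) (fun x : {x // P x} => s x) := by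
  refine ⟨Equiv.ofBijective (fun a => ⟨u a, (hP _).2 ⟨a, rfl⟩⟩) ⟨fun a b hab => ?_, ?_⟩,
    fun _ => rfl⟩
  · exact hu (congrArg Subtype.val hab)
  · rintro ⟨x, hx⟩
    obtain ⟨a, rfl⟩ := (hP x).1 hx
    exact ⟨a, rfl⟩

theorem of_isEmpty [IsEmpty X] [IsEmpty Y] (s : X → M) (t : Y → M) : Equidistributed s t :=
  ⟨Equiv.equivOfIsEmpty X Y, fun x => isEmptyElim x⟩

end Equidistributed

/-! Ancestor orders and parking records on an arbitrary finite linear order. -/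

section Structures

variable {α β : Type} [Fintype α] [LinearOrder α] [Fintype β] [LinearOrder β]

/-- `D v x`, read as `v` being a weak ancestor of `x`, is the ancestor relation of a rooted forest. -/
structure IsAncestry {α : Type} (D : α → α → Prop) : Prop where
  refl : ∀ x, D x x
  trans : ∀ x y z, D x y → D y z → D x z
  antisymm : ∀ x y, D x y → D y x → x = y
  chain : ∀ v w x, D v x → D w x → D v w ∨ D w v

/-- Rooted forests on `α`, encoded by their ancestor relation. -/
abbrev Ancestry (α : Type) : Type := {D : α → α → Prop // IsAncestry D}

open Classical in
/-- The contribution of `v` to the inversion type and to the number of trees. -/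
noncomputable def vertexWeight (D : α → α → Prop) (v : α) : Multiset ℕ × ℕ :=
  ({Finset.card {x | x < v ∧ D v x}}, if ∀ w, D w v → w = v then 1 else 0)

/-- The inversion type together with the number of trees. -/
noncomputable def forestWeight (D : Ancestry α) : Multiset ℕ × ℕ := ∑ v, vertexWeight D.1 v

/-- `q` is the successful outcome of the parking algorithm for the preferences `p`. -/
structure IsParkingRecord (p q : α → ℕ) : Prop where
  one_le : ∀ i, 1 ≤ p i
  le : ∀ i, p i ≤ q i
  le_card : ∀ i, q i ≤ Fintype.card α
  injective : Function.Injective q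
  occupied : ∀ i s, p i ≤ s → s < q i → ∃ j < i, q j = s

/-- Parking functions on the set of cars `α`, together with their outcomes. -/
abbrev ParkingRecord (α : Type) [Fintype α] [LinearOrder α] : Type :=
  {P : (α → ℕ) × (α → ℕ) // IsParkingRecord P.1 P.2}

open Classical in
/-- The contribution of the car `c` to the jump type and to the number of critical cars. -/
noncomputable def carWeight (P : (α → ℕ) × (α → ℕ)) (c : α) : Multiset ℕ × ℕ :=
  ({P.2 c - P.1 c},
    if ∀ s, P.2 c < s → s ≤ Fintype.card α → ∃ j ≤ c, P.2 j = s then 1 else 0)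

/-- The jump type together with the number of critical cars. -/
noncomputable def parkingWeight (P : ParkingRecord α) : Multiset ℕ × ℕ := ∑ c, carWeight P.1 c

/-- Weight of a structure assembled from a distinguished element of value `i`, a part whose
trees (or critical cars) do not count, and a part whose trees (or critical cars) count. -/
def combineWeight (i : ℕ) (a b : Multiset ℕ × ℕ) : Multiset ℕ × ℕ := ({i}, 1) + (a.1, 0) + b

theorem IsParkingRecord.exists_eq {p q : α → ℕ} (h : IsParkingRecord p q) {s : ℕ} (hs : 1 ≤ s)
    (hs' : s ≤ Fintype.card α) : ∃ j, q j = s := by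
  have himage : Finset.univ.image q = Finset.Icc 1 (Fintype.card α) := by
    apply Finset.eq_of_subset_of_card_le
    · intro t ht
      obtain ⟨j, -, rfl⟩ := Finset.mem_image.1 ht
      exact Finset.mem_Icc.2 ⟨(h.one_le j).trans (h.le j), h.le_card j⟩
    · rw [Finset.card_image_of_injective _ h.injective]
      simp
  have hmem : s ∈ Finset.univ.image q := by
    rw [himage]
    exact Finset.mem_Icc.2 ⟨hs, hs'⟩
  simpa using hmem

theorem IsParkingRecord.card_le {p q : α → ℕ} (h : IsParkingRecord p q) {s : ℕ}
    (hs : s ≤ Fintype.card α) : Finset.card {x | q x ≤ s} = s := by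
  have himage : ({x | q x ≤ s} : Finset α).image q = Finset.Icc 1 s := by
    ext t
    simp only [Finset.mem_image, Finset.mem_filter, Finset.mem_univ, true_and, Finset.mem_Icc]
    constructor
    · rintro ⟨j, hj, rfl⟩
      exact ⟨(h.one_le j).trans (h.le j), hj⟩
    · rintro ⟨h1, h2⟩
      obtain ⟨j, rfl⟩ := h.exists_eq h1 (h2.trans hs)
      exact ⟨j, h2, rfl⟩
  rw [← Finset.card_image_of_injective _ h.injective, himage]
  simp

/-- Records only depend on the order type of the set of cars. -/
theorem equidistributed_parkingWeight_of_card_eq (h : Fintype.card α = Fintype.card β) :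
    Equidistributed (parkingWeight (α := α)) (parkingWeight (α := β)) := by
  let e : α ≃o β := (Fintype.orderIsoFinOfCardEq α rfl).symm.trans
    (Fintype.orderIsoFinOfCardEq β h.symm)
  have transport : ∀ {γ δ : Type} [Fintype γ] [LinearOrder γ] [Fintype δ] [LinearOrder δ]
      (f : γ ≃o δ) (p q : γ → ℕ), IsParkingRecord p q →
      IsParkingRecord (p ∘ f.symm) (q ∘ f.symm) := by
    intro γ δ _ _ _ _ f p q hpq
    refine ⟨fun i => hpq.one_le _, fun i => hpq.le _, fun i => ?_,
      hpq.injective.comp f.symm.injective, fun i s h1 h2 => ?_⟩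
    · rw [← Fintype.card_congr f.toEquiv]
      exact hpq.le_card _
    · obtain ⟨j, hj, rfl⟩ := hpq.occupied _ s h1 h2
      exact ⟨f j, f.lt_symm_apply.1 hj, by simp⟩
  refine ⟨⟨fun P => ⟨(P.1.1 ∘ e.symm, P.1.2 ∘ e.symm), transport e _ _ P.2⟩, fun P => ⟨(P.1.1 ∘ e, P.1.2 ∘ e), transport e.symm _ _ P.2⟩,
    fun P => ?_, fun P => ?_⟩, fun P => ?_⟩
  · ext <;> simp
  · ext <;> simp
  · unfold parkingWeight
    rw [← e.toEquiv.sum_comp]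
    refine Finset.sum_congr rfl fun c _ => ?_
    simp only [carWeight, Equiv.coe_fn_mk, RelIso.coe_fn_toEquiv, Function.comp_apply,
      OrderIso.symm_apply_apply, h]
    congr 2
    refine propext (forall_congr' fun s => ?_)
    rw [e.symm_apply_apply, h]
    refine imp_congr_right fun _ => imp_congr_right fun _ => ?_
    constructor
    · rintro ⟨j, hj, rfl⟩
      exact ⟨e.symm j, e.symm_apply_le.2 hj, rfl⟩
    · rintro ⟨j, hj, rfl⟩
      exact ⟨e j, e.le_iff_le.2 hj, by simp⟩

/-- Splitting a sum along a distinguished element `r` of `B`, the rest of `B`, and `Bᶜ`. -/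
theorem sum_split {M : Type*} [AddCommMonoid M] {B : Finset α} {r : α} (hr : r ∈ B) (g : α → M) :
    ∑ v, g v = g r + ∑ v : B.erase r, g v + ∑ v : ↥Bᶜ, g v := by
  rw [Finset.sum_coe_sort (B.erase r) g, Finset.sum_coe_sort Bᶜ g, Finset.add_sum_erase B g hr,
    Finset.sum_add_sum_compl]

theorem card_filter_eq_card_filter_coe {γ : Type*} [Fintype γ] (S : Finset γ) (P : γ → Prop) (Q : S → Prop)
    [DecidablePred P] [DecidablePred Q]
    (h : ∀ x, P x ↔ ∃ hx : x ∈ S, Q ⟨x, hx⟩) :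
    Finset.card {x | P x} = Finset.card {x | Q x} := by
  symm
  refine Finset.card_bij (fun x _ => x.1) ?_ ?_ ?_
  · intro x hx
    simp only [Finset.mem_filter, Finset.mem_univ, true_and] at hx ⊢
    exact (h _).2 ⟨x.2, hx⟩
  · intro x _ y _ hxy
    exact Subtype.ext hxy
  · intro x hx
    simp only [Finset.mem_filter, Finset.mem_univ, true_and] at hx
    obtain ⟨hxS, hQ⟩ := (h x).1 hx
    exact ⟨⟨x, hxS⟩, by simpa using hQ, rfl⟩

/-! Assembling a forest from the tree containing a given vertex and the remaining trees. -/

/-- The ancestor relation on `α` in which `r` is the root of a tree with vertex set `B`. -/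
def glueAncestry (B : Finset α) (r : α) (D : B.erase r → B.erase r → Prop)
    (E : ↥Bᶜ → ↥Bᶜ → Prop) (v x : α) : Prop :=
  (v = r ∧ x ∈ B) ∨ (∃ hv hx, D ⟨v, hv⟩ ⟨x, hx⟩) ∨ (∃ hv hx, E ⟨v, hv⟩ ⟨x, hx⟩)

section Glue

variable {B : Finset α} {r : α} {D : B.erase r → B.erase r → Prop} {E : ↥Bᶜ → ↥Bᶜ → Prop}

theorem glueAncestry_root (x : α) : glueAncestry B r D E r x ↔ x ∈ B ∨
    ∃ hv hx, E ⟨r, hv⟩ ⟨x, hx⟩ := by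
  simp [glueAncestry]

theorem glueAncestry_erase (v : B.erase r) (x : α) :
    glueAncestry B r D E v x ↔ ∃ hx, D v ⟨x, hx⟩ := by
  obtain ⟨v, hv⟩ := v
  have hv' := hv
  rw [Finset.mem_erase] at hv'
  simp only [glueAncestry, hv'.1, false_and, false_or]
  constructor
  · rintro (⟨_, h⟩ | ⟨h, _⟩)
    · exact h
    · exact absurd hv'.2 (Finset.mem_compl.1 h)
  · exact fun h => Or.inl ⟨hv, h⟩

theorem glueAncestry_compl (hr : r ∈ B) (v : ↥Bᶜ) (x : α) :
    glueAncestry B r D E v x ↔ ∃ hx, E v ⟨x, hx⟩ := by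
  obtain ⟨v, hv⟩ := v
  have hv' := hv
  rw [Finset.mem_compl] at hv'
  constructor
  · rintro (⟨rfl, _⟩ | ⟨h, _⟩ | ⟨_, h⟩)
    · exact absurd hr hv'
    · exact absurd (Finset.mem_of_mem_erase h) hv'
    · exact h
  · exact fun h => Or.inr (Or.inr ⟨hv, h⟩)

theorem mem_cases (B : Finset α) (r v : α) :
    r = v ∨ (∃ w : B.erase r, v = w) ∨ (∃ w : ↥Bᶜ, v = w) := by
  by_cases h : v = r
  · exact Or.inl h.symm
  · by_cases hB : v ∈ B
    · exact Or.inr (Or.inl ⟨⟨v, Finset.mem_erase.2 ⟨h, hB⟩⟩, rfl⟩)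
    · exact Or.inr (Or.inr ⟨⟨v, Finset.mem_compl.2 hB⟩, rfl⟩)

theorem isAncestry_glueAncestry (hr : r ∈ B) (hD : IsAncestry D) (hE : IsAncestry E) :
    IsAncestry (glueAncestry B r D E) := by
  have hroot : ∀ x, glueAncestry B r D E r x ↔ x ∈ B := fun x => by
    rw [glueAncestry_root]
    exact or_iff_left fun ⟨hv, _⟩ => Finset.mem_compl.1 hv hr
  have hmemD : ∀ v : B.erase r, (v : α) ∈ B := fun v => Finset.mem_of_mem_erase v.2
  have hneD : ∀ v : B.erase r, (v : α) ≠ r := fun v => Finset.ne_of_mem_erase v.2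
  have hmemE : ∀ v : ↥Bᶜ, (v : α) ∉ B := fun v => Finset.mem_compl.1 v.2
  have hDD : ∀ v w : B.erase r, glueAncestry B r D E v w ↔ D v w := fun v w => by
    rw [glueAncestry_erase]; exact ⟨fun ⟨_, h⟩ => h, fun h => ⟨w.2, h⟩⟩
  have hEE : ∀ v w : ↥Bᶜ, glueAncestry B r D E v w ↔ E v w := fun v w => by
    rw [glueAncestry_compl hr]; exact ⟨fun ⟨_, h⟩ => h, fun h => ⟨w.2, h⟩⟩
  have hDr : ∀ v : B.erase r, ¬ glueAncestry B r D E v r := fun v => by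
    rw [glueAncestry_erase]; exact fun ⟨h, _⟩ => Finset.ne_of_mem_erase h rfl
  have hEr : ∀ v : ↥Bᶜ, ¬ glueAncestry B r D E v r := fun v => by
    rw [glueAncestry_compl hr]; exact fun ⟨h, _⟩ => Finset.mem_compl.1 h hr
  have hDE : ∀ (v : B.erase r) (w : ↥Bᶜ), ¬ glueAncestry B r D E v w := fun v w => by
    rw [glueAncestry_erase]; exact fun ⟨h, _⟩ => hmemE w (Finset.mem_of_mem_erase h)
  have hED : ∀ (v : ↥Bᶜ) (w : B.erase r), ¬ glueAncestry B r D E v w := fun v w => by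
    rw [glueAncestry_compl hr]; exact fun ⟨h, _⟩ => Finset.mem_compl.1 h (hmemD w)
  refine ⟨fun x => ?_, fun x y z => ?_, fun x y => ?_, fun v w x => ?_⟩
  · rcases mem_cases B r x with rfl | ⟨x, rfl⟩ | ⟨x, rfl⟩
    · simpa [hroot] using hr
    · exact (hDD _ _).2 (hD.refl x)
    · exact (hEE _ _).2 (hE.refl x)
  · rcases mem_cases B r x with rfl | ⟨x, rfl⟩ | ⟨x, rfl⟩ <;>
    rcases mem_cases B r y with rfl | ⟨y, rfl⟩ | ⟨y, rfl⟩ <;>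
    rcases mem_cases B r z with rfl | ⟨z, rfl⟩ | ⟨z, rfl⟩ <;>
    simp only [hroot, hDD, hEE, hDr, hEr, hDE, hED, hr, hmemD, hmemE] <;>
    first | tauto | exact hD.trans _ _ _ | exact hE.trans _ _ _
  · rcases mem_cases B r x with rfl | ⟨x, rfl⟩ | ⟨x, rfl⟩ <;>
    rcases mem_cases B r y with rfl | ⟨y, rfl⟩ | ⟨y, rfl⟩ <;>
    simp only [hroot, hDD, hEE, hDr, hEr, hDE, hED, hr, hmemD, hmemE] <;>
    first
      | tauto
      | exact fun h h' => congrArg _ (hD.antisymm _ _ h h')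
      | exact fun h h' => congrArg _ (hE.antisymm _ _ h h')
  · rcases mem_cases B r v with rfl | ⟨v, rfl⟩ | ⟨v, rfl⟩ <;>
    rcases mem_cases B r w with rfl | ⟨w, rfl⟩ | ⟨w, rfl⟩ <;>
    rcases mem_cases B r x with rfl | ⟨x, rfl⟩ | ⟨x, rfl⟩ <;>
    simp only [hroot, hDD, hEE, hDr, hEr, hDE, hED, hr, hmemD, hmemE] <;>
    first | tauto | exact hD.chain _ _ _ | exact hE.chain _ _ _

end Glue

/-- The forest in which `r` is the root of a tree with vertex set `B`, below which hangs the first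
forest, while the second forest consists of the remaining trees. -/
def glueForest {B : Finset α} {r : α} (hr : r ∈ B) (F : Ancestry (B.erase r) × Ancestry ↥Bᶜ) :
    Ancestry α :=
  ⟨glueAncestry B r F.1.1 F.2.1, isAncestry_glueAncestry hr F.1.2 F.2.2⟩

theorem glueForest_injective {B : Finset α} {r : α} (hr : r ∈ B) :
    Function.Injective (glueForest hr) := by
  rintro ⟨⟨D, hD⟩, ⟨E, hE⟩⟩ ⟨⟨D', hD'⟩, ⟨E', hE'⟩⟩ h
  have h' : glueAncestry B r D E = glueAncestry B r D' E' := congrArg Subtype.val h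
  have h1 : D = D' := by
    funext v x
    have := congrFun (congrFun h' v) x
    rw [glueAncestry_erase, glueAncestry_erase] at this
    simpa using this
  have h2 : E = E' := by
    funext v x
    have := congrFun (congrFun h' v) x
    rw [glueAncestry_compl hr, glueAncestry_compl hr] at this
    have hx := Finset.mem_compl.1 x.2
    simpa [hx] using this
  subst h1 h2
  rfl

theorem exists_glueForest_eq_iff {B : Finset α} {r : α} (hr : r ∈ B) (F : Ancestry α) :
    (∃ G, glueForest hr G = F) ↔ (∀ w, F.1 w r → w = r) ∧ ∀ x, F.1 r x ↔ x ∈ B := by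
  constructor
  · rintro ⟨⟨⟨D, hD⟩, ⟨E, hE⟩⟩, rfl⟩
    constructor
    · intro w hw
      rcases mem_cases B r w with rfl | ⟨w, rfl⟩ | ⟨w, rfl⟩
      · rfl
      · obtain ⟨h, _⟩ := (glueAncestry_erase w r).1 hw
        exact absurd rfl (Finset.ne_of_mem_erase h)
      · obtain ⟨h, _⟩ := (glueAncestry_compl hr w r).1 hw
        exact absurd hr (Finset.mem_compl.1 h)
    · intro x
      refine (glueAncestry_root x).trans (or_iff_left ?_)
      exact fun ⟨hv, _⟩ => Finset.mem_compl.1 hv hr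
  · rintro ⟨hroot, hB⟩
    obtain ⟨F, hF⟩ := F
    have hrestrict : ∀ S : Finset α, IsAncestry (fun v x : S => F v x) := fun S =>
      ⟨fun x => hF.refl _, fun x y z => hF.trans _ _ _,
        fun x y h h' => Subtype.ext (hF.antisymm _ _ h h'), fun v w x => hF.chain _ _ _⟩
    refine ⟨⟨⟨_, hrestrict _⟩, ⟨_, hrestrict _⟩⟩, Subtype.ext ?_⟩
    funext v x
    refine propext ?_
    rcases mem_cases B r v with rfl | ⟨v, rfl⟩ | ⟨v, rfl⟩
    · refine (glueAncestry_root x).trans ((or_iff_left ?_).trans (hB x).symm)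
      exact fun ⟨hv, _⟩ => Finset.mem_compl.1 hv hr
    · refine (glueAncestry_erase v x).trans ⟨fun ⟨_, h⟩ => h, fun h => ⟨?_, h⟩⟩
      refine Finset.mem_erase.2 ⟨?_, ?_⟩
      · rintro rfl
        exact Finset.ne_of_mem_erase v.2 (hroot _ h)
      · exact (hB x).1 (hF.trans _ _ _ ((hB v).2 (Finset.mem_of_mem_erase v.2)) h)
    · refine (glueAncestry_compl hr v x).trans ⟨fun ⟨_, h⟩ => h, fun h => ⟨?_, h⟩⟩
      refine Finset.mem_compl.2 fun hx => Finset.mem_compl.1 v.2 ?_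
      rcases hF.chain _ _ _ h ((hB x).2 hx) with h' | h'
      · rw [hroot _ h']; exact hr
      · exact (hB _).1 h'

theorem forestWeight_glueForest {B : Finset α} {r : α} (hr : r ∈ B)
    (F : Ancestry (B.erase r) × Ancestry ↥Bᶜ) :
    forestWeight (glueForest hr F) =
      combineWeight (Finset.card {x ∈ B | x < r}) (forestWeight F.1) (forestWeight F.2) := by
  classical
  obtain ⟨hroot, hB⟩ := (exists_glueForest_eq_iff hr (glueForest hr F)).1 ⟨F, rfl⟩
  unfold forestWeight
  rw [sum_split hr, combineWeight]
  congr 1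
  · congr 1
    · rw [vertexWeight, if_pos hroot]
      congr 3
      ext x
      simp [hB, and_comm]
    · rw [Prod.ext_iff, Prod.fst_sum, Prod.snd_sum, Prod.fst_sum]
      constructor
      · refine Finset.sum_congr rfl fun v _ => ?_
        refine congrArg (fun k : ℕ => ({k} : Multiset ℕ)) (card_filter_eq_card_filter_coe _ _ _ fun x => ?_)
        simp only [glueForest, glueAncestry_erase]
        exact ⟨fun ⟨h, hx, h'⟩ => ⟨hx, h, h'⟩, fun ⟨hx, h, h'⟩ => ⟨h, hx, h'⟩⟩
      · refine Finset.sum_eq_zero fun v _ => if_neg fun h => ?_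
        exact Finset.ne_of_mem_erase v.2
          (h r ((hB v).2 (Finset.mem_of_mem_erase v.2))).symm
  · refine Finset.sum_congr rfl fun v _ => ?_
    refine Prod.ext ?_ ?_
    · refine congrArg (fun k : ℕ => ({k} : Multiset ℕ)) (card_filter_eq_card_filter_coe _ _ _ fun x => ?_)
      simp only [glueForest, glueAncestry_compl hr]
      exact ⟨fun ⟨h, hx, h'⟩ => ⟨hx, h, h'⟩, fun ⟨hx, h, h'⟩ => ⟨h, hx, h'⟩⟩
    · simp only [vertexWeight]
      congr 1
      refine propext ⟨fun h w hw => ?_, fun h w hw => ?_⟩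
      · exact Subtype.ext (h w ((glueAncestry_compl hr w v).2 ⟨v.2, hw⟩))
      · rcases mem_cases B r w with rfl | ⟨w, rfl⟩ | ⟨w, rfl⟩
        · exact absurd ((hB v).1 hw) (Finset.mem_compl.1 v.2)
        · obtain ⟨hv, _⟩ := (glueAncestry_erase w v).1 hw
          exact absurd (Finset.mem_of_mem_erase hv) (Finset.mem_compl.1 v.2)
        · obtain ⟨_, hwv⟩ := (glueAncestry_compl hr w v).1 hw
          exact congrArg _ (h w hwv)

/-! Assembling a parking record from the cars to the left and to the right of the last car. -/

/-- Extend `f` on `B.erase m` and `g` on `Bᶜ` (shifted by `#B`) by the value `c` at `m`. -/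
def glueSpaces (B : Finset α) (m : α) (c : ℕ) (f : B.erase m → ℕ) (g : ↥Bᶜ → ℕ) (x : α) : ℕ :=
  if h : x ∈ B.erase m then f ⟨x, h⟩ else if h : x ∈ Bᶜ then B.card + g ⟨x, h⟩ else c

section GlueSpaces

variable {B : Finset α} {m : α} {c : ℕ} {f : B.erase m → ℕ} {g : ↥Bᶜ → ℕ}

theorem glueSpaces_self (hm : m ∈ B) : glueSpaces B m c f g m = c := by
  simp [glueSpaces, hm]

theorem glueSpaces_erase (x : B.erase m) : glueSpaces B m c f g x = f x :=
  dif_pos x.2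

theorem glueSpaces_compl (x : ↥Bᶜ) : glueSpaces B m c f g x = B.card + g x := by
  have h : (x : α) ∉ B.erase m := fun h => Finset.mem_compl.1 x.2 (Finset.mem_of_mem_erase h)
  exact (dif_neg h).trans (dif_pos x.2)

end GlueSpaces

theorem isParkingRecord_glueSpaces {B : Finset α} {m : α} (hm : m ∈ B) (hmax : ∀ x, x ≤ m)
    {i : ℕ} (hi : i < B.card) {p q : B.erase m → ℕ} {p' q' : ↥Bᶜ → ℕ}
    (h : IsParkingRecord p q) (h' : IsParkingRecord p' q') :
    IsParkingRecord (glueSpaces B m (B.card - i) p p') (glueSpaces B m B.card q q') := by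
  have hcard : Fintype.card (B.erase m) = B.card - 1 := by
    rw [Fintype.card_coe, Finset.card_erase_of_mem hm]
  have hcard' : B.card + Fintype.card ↥Bᶜ = Fintype.card α := by
    rw [Fintype.card_coe, Finset.card_add_card_compl]
  have hltD : ∀ x, q x < B.card := fun x => by
    have := h.le_card x
    omega
  have hposE : ∀ x, 0 < q' x := fun x => (h'.one_le x).trans (h'.le x)
  refine ⟨fun x => ?_, fun x => ?_, fun x => ?_, fun x y hxy => ?_, fun x s h1 h2 => ?_⟩
  · rcases mem_cases B m x with rfl | ⟨x, rfl⟩ | ⟨x, rfl⟩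
    · rw [glueSpaces_self hm]; omega
    · rw [glueSpaces_erase]; exact h.one_le x
    · rw [glueSpaces_compl]; have := h'.one_le x; omega
  · rcases mem_cases B m x with rfl | ⟨x, rfl⟩ | ⟨x, rfl⟩
    · simp only [glueSpaces_self hm]; omega
    · simp only [glueSpaces_erase]; exact h.le x
    · simp only [glueSpaces_compl]; have := h'.le x; omega
  · rcases mem_cases B m x with rfl | ⟨x, rfl⟩ | ⟨x, rfl⟩
    · rw [glueSpaces_self hm]; omega
    · rw [glueSpaces_erase]; have := hltD x; omega
    · rw [glueSpaces_compl]; have := h'.le_card x; omega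
  · rcases mem_cases B m x with rfl | ⟨x, rfl⟩ | ⟨x, rfl⟩ <;>
    rcases mem_cases B m y with rfl | ⟨y, rfl⟩ | ⟨y, rfl⟩ <;>
    simp only [glueSpaces_self hm, glueSpaces_erase, glueSpaces_compl] at hxy
    · rfl
    · have := hltD y; omega
    · have := hposE y; omega
    · have := hltD x; omega
    · exact congrArg _ (h.injective hxy)
    · have := hltD x; omega
    · have := hposE x; omega
    · have := hltD y; omega
    · exact congrArg _ (h'.injective (Nat.add_left_cancel hxy))
  · rcases mem_cases B m x with rfl | ⟨x, rfl⟩ | ⟨x, rfl⟩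
    · rw [glueSpaces_self hm] at h1 h2
      obtain ⟨j, rfl⟩ := h.exists_eq (s := s) (by omega) (by omega)
      exact ⟨j, lt_of_le_of_ne (hmax _) (Finset.ne_of_mem_erase j.2), glueSpaces_erase j⟩
    · rw [glueSpaces_erase] at h1 h2
      obtain ⟨j, hj, rfl⟩ := h.occupied x s h1 h2
      exact ⟨j, hj, glueSpaces_erase j⟩
    · rw [glueSpaces_compl] at h1 h2
      obtain ⟨j, hj, hjs⟩ := h'.occupied x (s - B.card) (by omega) (by omega)
      exact ⟨j, hj, by rw [glueSpaces_compl]; omega⟩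

/-- The parking record in which the last car `m` makes `i` jumps, and the cars that park to the
left (right) of it are those of `B.erase m` (of `Bᶜ`). -/
def glueRecord {B : Finset α} {m : α} (hm : m ∈ B) (hmax : ∀ x, x ≤ m) {i : ℕ}
    (hi : i < B.card) (P : ParkingRecord (B.erase m) × ParkingRecord ↥Bᶜ) : ParkingRecord α :=
  ⟨(glueSpaces B m (B.card - i) P.1.1.1 P.2.1.1, glueSpaces B m B.card P.1.1.2 P.2.1.2),
    isParkingRecord_glueSpaces hm hmax hi P.1.2 P.2.2⟩

section GlueRecord

variable {B : Finset α} {m : α} {i : ℕ}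

theorem glueRecord_injective (hm : m ∈ B) (hmax : ∀ x, x ≤ m) (hi : i < B.card) :
    Function.Injective (glueRecord hm hmax hi) := by
  rintro ⟨⟨⟨p, q⟩, h⟩, ⟨⟨p', q'⟩, h'⟩⟩ ⟨⟨⟨u, v⟩, k⟩, ⟨⟨u', v'⟩, k'⟩⟩ heq
  have heq' := congrArg Subtype.val heq
  simp only [glueRecord, Prod.mk.injEq] at heq'
  obtain ⟨hp, hq⟩ := heq'
  have hext : ∀ {c : ℕ} {f f₁ : B.erase m → ℕ} {g g₁ : ↥Bᶜ → ℕ},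
      glueSpaces B m c f g = glueSpaces B m c f₁ g₁ → f = f₁ ∧ g = g₁ := by
    intro c f f₁ g g₁ hc
    constructor
    · funext x
      simpa only [glueSpaces_erase] using congrFun hc x
    · funext x
      simpa only [glueSpaces_compl, Nat.add_left_cancel_iff] using congrFun hc x
  obtain ⟨rfl, rfl⟩ := hext hp
  obtain ⟨rfl, rfl⟩ := hext hq
  rfl

theorem exists_glueRecord_eq_iff (hm : m ∈ B) (hmax : ∀ x, x ≤ m) (hi : i < B.card)
    (P : ParkingRecord α) : (∃ Q, glueRecord hm hmax hi Q = P) ↔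
      (∀ x, P.1.2 x ≤ P.1.2 m ↔ x ∈ B) ∧ P.1.2 m - P.1.1 m = i := by
  have hcard : Fintype.card (B.erase m) = B.card - 1 := by
    rw [Fintype.card_coe, Finset.card_erase_of_mem hm]
  have hcard' : B.card + Fintype.card ↥Bᶜ = Fintype.card α := by
    rw [Fintype.card_coe, Finset.card_add_card_compl]
  constructor
  · rintro ⟨⟨⟨⟨p, q⟩, h⟩, ⟨⟨p', q'⟩, h'⟩⟩, rfl⟩
    simp only [glueRecord, glueSpaces_self hm]
    refine ⟨fun x => ?_, by omega⟩
    rcases mem_cases B m x with rfl | ⟨x, rfl⟩ | ⟨x, rfl⟩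
    · simp [glueSpaces_self hm, hm]
    · rw [glueSpaces_erase]
      have := h.le_card x
      simp only at this
      exact ⟨fun _ => Finset.mem_of_mem_erase x.2, fun _ => by omega⟩
    · rw [glueSpaces_compl]
      have := (h'.one_le x).trans (h'.le x)
      simp only at this
      exact ⟨fun _ => by omega, fun hx => absurd hx (Finset.mem_compl.1 x.2)⟩
  · rintro ⟨hB, hi'⟩
    obtain ⟨⟨p, q⟩, h⟩ := P
    simp only at hB hi' h
    have hqm : B.card = q m := by
      rw [← h.card_le (h.le_card m)]
      congr 1
      ext x
      simp [hB]
    have hlt : ∀ x : B.erase m, q x < q m := fun x =>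
      lt_of_le_of_ne ((hB x).2 (Finset.mem_of_mem_erase x.2))
        fun hx => Finset.ne_of_mem_erase x.2 (h.injective hx)
    have hgt : ∀ x : ↥Bᶜ, q m < p x := fun x => by
      by_contra hx
      have hqx : q m < q x := not_le.1 fun hle => Finset.mem_compl.1 x.2 ((hB x).1 hle)
      obtain ⟨j, hj, hjm⟩ := h.occupied x (q m) (not_lt.1 hx) hqx
      rw [h.injective hjm] at hj
      exact absurd (hmax x) (not_le.2 hj)
    have hle : IsParkingRecord (fun x : B.erase m => p x) (fun x : B.erase m => q x) := by
      refine ⟨fun x => h.one_le _, fun x => h.le _, fun x => ?_, fun x y hxy => ?_,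
        fun x s h1 h2 => ?_⟩
      · have := hlt x
        omega
      · exact Subtype.ext (h.injective hxy)
      · obtain ⟨j, hj, rfl⟩ := h.occupied x s h1 h2
        have hjm : q j < q m := h2.trans (hlt x)
        refine ⟨⟨j, Finset.mem_erase.2 ⟨?_, (hB j).1 hjm.le⟩⟩, hj, rfl⟩
        rintro rfl
        exact lt_irrefl _ hjm
    have hge : IsParkingRecord (fun x : ↥Bᶜ => p x - q m) (fun x : ↥Bᶜ => q x - q m) := by
      refine ⟨fun x => ?_, fun x => ?_, fun x => ?_, fun x y hxy => ?_, fun x s h1 h2 => ?_⟩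
      · have := hgt x
        omega
      · have := h.le x
        omega
      · have := h.le_card x
        omega
      · have hx := (hgt x).trans_le (h.le x)
        have hy := (hgt y).trans_le (h.le y)
        exact Subtype.ext (h.injective (by omega))
      · have := hgt x
        obtain ⟨j, hj, hjs⟩ := h.occupied x (s + q m) (by omega) (by omega)
        refine ⟨⟨j, Finset.mem_compl.2 fun hjB => ?_⟩, hj, by simp only; omega⟩
        have := (hB j).2 hjB
        omega
    refine ⟨⟨⟨(_, _), hle⟩, ⟨(_, _), hge⟩⟩, Subtype.ext (Prod.ext ?_ ?_)⟩ <;> funext x <;>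
      rcases mem_cases B m x with rfl | ⟨x, rfl⟩ | ⟨x, rfl⟩ <;>
      simp only [glueRecord, glueSpaces_self hm, glueSpaces_erase, glueSpaces_compl]
    · have := h.le m
      omega
    · have := hgt x
      omega
    · exact hqm
    · have := (hgt x).trans_le (h.le x)
      omega

theorem parkingWeight_glueRecord (hm : m ∈ B) (hmax : ∀ x, x ≤ m) (hi : i < B.card)
    (P : ParkingRecord (B.erase m) × ParkingRecord ↥Bᶜ) :
    parkingWeight (glueRecord hm hmax hi P) =
      combineWeight i (parkingWeight P.1) (parkingWeight P.2) := by
  classical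
  have hcard' : B.card + Fintype.card ↥Bᶜ = Fintype.card α := by
    rw [Fintype.card_coe, Finset.card_add_card_compl]
  obtain ⟨⟨⟨p, q⟩, h⟩, ⟨⟨p', q'⟩, h'⟩⟩ := P
  have hG := isParkingRecord_glueSpaces hm hmax hi h h'
  simp only at h h' hG
  have hcard : Fintype.card (B.erase m) = B.card - 1 := by
    rw [Fintype.card_coe, Finset.card_erase_of_mem hm]
  unfold parkingWeight
  rw [sum_split hm, combineWeight]
  simp only [glueRecord]
  congr 1
  · congr 1
    · rw [carWeight]
      refine Prod.ext ?_ (if_pos fun s h1 h2 => ?_)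
      · simp only [glueSpaces_self hm]
        congr 1
        omega
      · obtain ⟨j, hj⟩ := hG.exists_eq (s := s) (by omega) h2
        exact ⟨j, hmax j, hj⟩
    · rw [Prod.ext_iff, Prod.fst_sum, Prod.snd_sum, Prod.fst_sum]
      constructor
      · refine Finset.sum_congr rfl fun c _ => ?_
        simp only [carWeight, glueSpaces_erase]
      · refine Finset.sum_eq_zero fun c _ => if_neg fun hc => ?_
        have hqc := h.le_card c
        obtain ⟨j, hj, hjm⟩ := hc B.card (by simp only [glueSpaces_erase]; omega) (by omega)
        have : j = m := hG.injective (hjm.trans (glueSpaces_self hm).symm)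
        subst this
        exact Finset.ne_of_mem_erase c.2 (le_antisymm (hmax _) hj)
  · refine Finset.sum_congr rfl fun c _ => ?_
    simp only [carWeight, glueSpaces_compl]
    refine Prod.ext (by simp only [Nat.add_sub_add_left]) ?_
    simp only
    congr 1
    refine propext ⟨fun hc s h1 h2 => ?_, fun hc s h1 h2 => ?_⟩
    · obtain ⟨j, hj, hjs⟩ := hc (B.card + s) (by omega) (by omega)
      rcases mem_cases B m j with rfl | ⟨j, rfl⟩ | ⟨j, rfl⟩
      · rw [glueSpaces_self hm] at hjs
        omega
      · have := h.le_card j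
        rw [glueSpaces_erase] at hjs
        omega
      · rw [glueSpaces_compl] at hjs
        exact ⟨j, hj, by omega⟩
    · obtain ⟨j, hj, hjs⟩ := hc (s - B.card) (by omega) (by omega)
      exact ⟨j, hj, by rw [glueSpaces_compl]; omega⟩

end GlueRecord

/-! The two families have the same recursive structure. -/

theorem IsAncestry.exists_root {γ : Type} [Finite γ] {D : γ → γ → Prop} (hD : IsAncestry D)
    (x : γ) :
    ∃ r, D r x ∧ ∀ w, D w r → w = r := by
  classical
  have := Fintype.ofFinite γ
  obtain ⟨r, hr, hmin⟩ := Finset.exists_min_image {r | D r x}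
    (fun r => Finset.card {w | D w r}) ⟨x, by simp [hD.refl]⟩
  simp only [Finset.mem_filter, Finset.mem_univ, true_and] at hr hmin
  refine ⟨r, hr, fun w hw => by_contra fun hne => ?_⟩
  refine absurd (hmin w (hD.trans _ _ _ hw hr)) (not_le.2 (Finset.card_lt_card ?_))
  refine Finset.ssubset_iff_subset_ne.2 ⟨fun z hz => ?_, fun heq => ?_⟩
  · simp only [Finset.mem_filter, Finset.mem_univ, true_and] at hz ⊢
    exact hD.trans _ _ _ hz hw
  · have : r ∈ ({z | D z r} : Finset γ) := by simp [hD.refl]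
    rw [← heq] at this
    exact hne (hD.antisymm _ _ hw (by simpa using this))

/-- Every rank below `#B` is attained by a unique element of `B`. -/
theorem exists_unique_rank {γ : Type*} [LinearOrder γ] (B : Finset γ) {i : ℕ} (hi : i < B.card) :
    ∃ r ∈ B, ∀ x ∈ B, (Finset.card {y ∈ B | y < x} = i ↔ x = r) := by
  have hlt : ∀ x ∈ B, Finset.card {y ∈ B | y < x} < B.card := fun x hx =>
    Finset.card_lt_card (Finset.filter_ssubset.2 ⟨x, hx, lt_irrefl x⟩)
  have hmono : ∀ x ∈ B, ∀ y ∈ B, x < y →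
      Finset.card {z ∈ B | z < x} < Finset.card {z ∈ B | z < y} := by
    intro x hx y hy hxy
    refine Finset.card_lt_card (Finset.ssubset_iff_of_subset ?_ |>.2 ⟨x, ?_, ?_⟩)
    · intro z hz
      rw [Finset.mem_filter] at hz ⊢
      exact ⟨hz.1, hz.2.trans hxy⟩
    · simp [hx, hxy]
    · simp
  have hinj : ∀ x ∈ B, ∀ y ∈ B,
      Finset.card {z ∈ B | z < x} = Finset.card {z ∈ B | z < y} → x = y := by
    intro x hx y hy h
    rcases lt_trichotomy x y with hxy | hxy | hxy
    · exact absurd h (hmono x hx y hy hxy).ne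
    · exact hxy
    · exact absurd h (hmono y hy x hx hxy).ne'
  have himage : B.image (fun x => Finset.card {z ∈ B | z < x}) = Finset.range B.card := by
    apply Finset.eq_of_subset_of_card_le
    · intro t ht
      obtain ⟨x, hx, rfl⟩ := Finset.mem_image.1 ht
      exact Finset.mem_range.2 (hlt x hx)
    · rw [Finset.card_image_of_injOn fun x hx y hy => hinj x hx y hy]
      simp
  have hmem := Finset.mem_range.2 hi
  rw [← himage, Finset.mem_image] at hmem
  obtain ⟨r, hr, hri⟩ := hmem
  exact ⟨r, hr, fun x hx => ⟨fun h => hinj x hx r hr (h.trans hri.symm), fun h => h ▸ hri⟩⟩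

theorem equidistributed_forestWeight_parkingWeight (N : ℕ) :
    ∀ (α : Type) [Fintype α] [LinearOrder α], Fintype.card α = N →
      Equidistributed (forestWeight (α := α)) (parkingWeight (α := α)) := by
  classical
  induction N using Nat.strong_induction_on with
  | _ N ih =>
  intro α _ _ hα
  rcases isEmpty_or_nonempty α with hempty | hnonempty
  · have : Unique (Ancestry α) :=
      ⟨⟨⟨fun _ _ => True, by constructor <;> intro x <;> exact isEmptyElim x⟩⟩,
        fun D => Subtype.ext (funext fun x => isEmptyElim x)⟩
    have : Unique (ParkingRecord α) :=
      ⟨⟨⟨(fun _ => 0, fun _ => 0), by constructor <;> intro x <;> exact isEmptyElim x⟩⟩,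
        fun D => Subtype.ext (Prod.ext (funext fun x => isEmptyElim x)
          (funext fun x => isEmptyElim x))⟩
    exact ⟨Equiv.ofUnique _ _, fun D => by simp [forestWeight, parkingWeight]⟩
  obtain ⟨m, hmax⟩ := Finite.exists_max (id : α → α)
  simp only [id] at hmax
  have hex : ∀ D : Ancestry α, ∃ r, D.1 r m ∧ ∀ w, D.1 w r → w = r := fun D =>
    D.2.exists_root m
  choose root hroot hmaximal using hex
  let tree : Ancestry α → Finset α := fun D => Finset.univ.filter (D.1 (root D))
  refine Equidistributed.of_fibers
    (fun D => (tree D, Finset.card {x ∈ tree D | x < root D}))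
    (fun P => (Finset.univ.filter (fun x => P.1.2 x ≤ P.1.2 m), P.1.2 m - P.1.1 m)) ?_
  rintro ⟨B, i⟩
  by_cases hB : m ∈ B ∧ i < B.card
  · obtain ⟨hm, hi⟩ := hB
    obtain ⟨r, hr, hrank⟩ := exists_unique_rank B hi
    have hri := (hrank r hr).2 rfl
    have hleft := Equidistributed.of_parametrization (forestWeight (α := α)) (glueForest hr)
      (P := fun D => (tree D, Finset.card {x ∈ tree D | x < root D}) = (B, i))
      (glueForest_injective hr) (fun D => by
        rw [exists_glueForest_eq_iff, Prod.mk.injEq]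
        constructor
        · rintro ⟨hBD, hiD⟩
          rw [hBD] at hiD
          have hrootB : root D ∈ B := by
            rw [← hBD]
            simp [tree, D.2.refl]
          have hrr := (hrank _ hrootB).1 hiD
          refine ⟨hrr ▸ hmaximal D, fun x => ?_⟩
          rw [← hrr, ← hBD]
          simp [tree]
        · rintro ⟨hmaxr, hBr⟩
          have hrr : root D = r := by
            rcases D.2.chain _ _ _ (hroot D) ((hBr m).2 hm) with h | h
            · exact hmaxr _ h
            · exact (hmaximal D _ h).symm
          have hBD : tree D = B := by
            ext x
            simp [tree, hrr, hBr]
          rw [hBD, hrr]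
          exact ⟨rfl, hri⟩)
    have hright := Equidistributed.of_parametrization (parkingWeight (α := α))
      (glueRecord hm hmax hi)
      (P := fun P => (Finset.univ.filter (fun x => P.1.2 x ≤ P.1.2 m), P.1.2 m - P.1.1 m) = (B, i))
      (glueRecord_injective hm hmax hi) (fun P => by
        rw [exists_glueRecord_eq_iff, Prod.mk.injEq, Finset.ext_iff]
        simp)
    simp only [forestWeight_glueForest, hri] at hleft
    simp only [parkingWeight_glueRecord] at hright
    refine hleft.symm.trans (Equidistributed.trans ?_ hright)
    have hcardB : B.card ≤ N := hα ▸ Finset.card_le_univ B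
    have hcardr : Fintype.card (B.erase r) = B.card - 1 := by
      rw [Fintype.card_coe, Finset.card_erase_of_mem hr]
    have hcardm : Fintype.card (B.erase m) = B.card - 1 := by
      rw [Fintype.card_coe, Finset.card_erase_of_mem hm]
    have hcardc : Fintype.card ↥Bᶜ = N - B.card := by
      rw [Fintype.card_coe, Finset.card_compl, hα]
    refine Equidistributed.prod (Equidistributed.trans (ih (B.card - 1) (by omega) _ hcardr)
      (equidistributed_parkingWeight_of_card_eq (hcardr.trans hcardm.symm)))
      (ih (N - B.card) (by omega) _ hcardc) (combineWeight i)
  · have hF : IsEmpty {D : Ancestry α //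
        (tree D, Finset.card {x ∈ tree D | x < root D}) = (B, i)} := by
      refine ⟨fun ⟨D, hD⟩ => hB ?_⟩
      rw [Prod.mk.injEq] at hD
      obtain ⟨hBD, hiD⟩ := hD
      rw [← hiD, ← hBD]
      refine ⟨by simp [tree, hroot], Finset.card_lt_card (Finset.filter_ssubset.2
        ⟨root D, by simp [tree, D.2.refl], lt_irrefl _⟩)⟩
    have hP : IsEmpty {P : ParkingRecord α //
        (Finset.univ.filter (fun x => P.1.2 x ≤ P.1.2 m), P.1.2 m - P.1.1 m) = (B, i)} := by
      refine ⟨fun ⟨P, hP⟩ => hB ?_⟩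
      rw [Prod.mk.injEq] at hP
      obtain ⟨hBP, hiP⟩ := hP
      rw [← hiP, ← hBP, P.2.card_le (P.2.le_card m)]
      have := P.2.one_le m
      have := P.2.le m
      exact ⟨by simp, by omega⟩
    exact Equidistributed.of_isEmpty _ _

end Structures

/-! Forests given by parent functions. -/

section ParentFunctions

variable {n : ℕ}

theorem eq_none_iff_forall_descendant {par : Fin n → Option (Fin n)} (h : IsForest par)
    (v : Fin n) : par v = none ↔ ∀ w, Descendant par w v → w = v := by
  constructor
  · intro hv w hw
    rcases Relation.ReflTransGen.cases_head hw with rfl | ⟨c, hc, _⟩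
    · rfl
    · rw [hv] at hc
      exact absurd hc (by simp)
  · intro hv
    by_contra hne
    obtain ⟨c, hc⟩ := Option.ne_none_iff_exists'.1 hne
    have := hv c (Relation.ReflTransGen.single hc)
    subst this
    exact h c (Relation.TransGen.single hc)

theorem isAncestry_descendant {par : Fin n → Option (Fin n)} (h : IsForest par) :
    IsAncestry (Descendant par) where
  refl _ := Relation.ReflTransGen.refl
  trans _ _ _ hxy hyz := Relation.ReflTransGen.trans hyz hxy
  antisymm x y hxy hyx := by
    rcases Relation.reflTransGen_iff_eq_or_transGen.1 hxy with rfl | hxy'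
    · rfl
    · exact absurd (hxy'.trans_left hyx) (h y)
  chain v w x hv hw := by
    refine (Relation.ReflTransGen.total_of_right_unique ?_ hv hw).symm
    intro a b c hab hac
    exact Option.some.inj (hab.symm.trans hac)

/-- `y` is the closest strict ancestor of `x`. -/
def IsParent {α : Type} (D : α → α → Prop) (x y : α) : Prop :=
  y ≠ x ∧ D y x ∧ ∀ z, z ≠ x → D z x → D z y

theorem IsAncestry.isParent_unique {α : Type} {D : α → α → Prop} (hD : IsAncestry D) {x y z : α}
    (hy : IsParent D x y) (hz : IsParent D x z) : y = z :=
  hD.antisymm _ _ (hz.2.2 y hy.1 hy.2.1) (hy.2.2 z hz.1 hz.2.1)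

theorem eq_some_iff_isParent {par : Fin n → Option (Fin n)} (h : IsForest par) (x y : Fin n) :
    par x = some y ↔ IsParent (Descendant par) x y := by
  have hparent : ∀ c, par x = some c → IsParent (Descendant par) x c := by
    intro c hc
    refine ⟨?_, Relation.ReflTransGen.single hc, fun z hz hzx => ?_⟩
    · rintro rfl
      exact h c (Relation.TransGen.single hc)
    · rcases Relation.ReflTransGen.cases_head hzx with rfl | ⟨d, hd, hdz⟩
      · exact absurd rfl hz
      · rw [hc, Option.some.injEq] at hd
        exact hd ▸ hdz
  refine ⟨hparent y, fun hy => ?_⟩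
  rcases Relation.ReflTransGen.cases_head hy.2.1 with hxy | ⟨c, hc, _⟩
  · exact absurd hxy.symm hy.1
  · rw [hc, (isAncestry_descendant h).isParent_unique (hparent c hc) hy]

theorem IsAncestry.exists_isParent {D : Fin n → Fin n → Prop} (hD : IsAncestry D) {x v : Fin n}
    (hv : D v x) (hne : v ≠ x) : ∃ y, IsParent D x y := by
  classical
  obtain ⟨y, hy, hmax⟩ := Finset.exists_max_image {y | y ≠ x ∧ D y x}
    (fun y => Finset.card {w | D w y}) ⟨v, by simp [hv, hne]⟩
  simp only [Finset.mem_filter, Finset.mem_univ, true_and] at hy hmax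
  refine ⟨y, hy.1, hy.2, fun z hzx hz => ?_⟩
  rcases hD.chain _ _ _ hz hy.2 with h | h
  · exact h
  · have hsub : ({w | D w y} : Finset (Fin n)) ⊆ ({w | D w z} : Finset (Fin n)) := by
      intro w hw
      simp only [Finset.mem_filter, Finset.mem_univ, true_and] at hw ⊢
      exact hD.trans _ _ _ hw h
    have hmem : z ∈ ({w | D w z} : Finset (Fin n)) := by simp [hD.refl]
    rw [← Finset.eq_of_subset_of_card_le hsub (hmax z ⟨hzx, hz⟩)] at hmem
    simpa using hmem

theorem IsAncestry.exists_isForest {D : Fin n → Fin n → Prop} (hD : IsAncestry D) :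
    ∃ par, IsForest par ∧ Descendant par = D := by
  classical
  let par : Fin n → Option (Fin n) := fun x =>
    if h : ∃ y, IsParent D x y then some h.choose else none
  have hpar : ∀ x y, par x = some y ↔ IsParent D x y := by
    intro x y
    by_cases h : ∃ y, IsParent D x y
    · have hx : par x = some h.choose := dif_pos h
      rw [hx, Option.some.injEq]
      exact ⟨fun hy => hy ▸ h.choose_spec, fun hy => hD.isParent_unique h.choose_spec hy⟩
    · have hx : par x = none := dif_neg h
      rw [hx]
      exact ⟨fun hy => absurd hy (by simp), fun hy => absurd ⟨y, hy⟩ h⟩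
  have hsound : ∀ v x, Descendant par v x → D v x := by
    intro v x hvx
    induction hvx with
    | refl => exact hD.refl _
    | tail _ hbc ih => exact hD.trans _ _ _ ((hpar _ _).1 hbc).2.1 ih
  have hcomplete : ∀ k v x, Finset.card {w | D w x} = k → D v x → Descendant par v x := by
    intro k
    induction k using Nat.strong_induction_on with
    | _ k ih =>
    intro v x hk hvx
    by_cases hne : v = x
    · subst hne
      exact Relation.ReflTransGen.refl
    · obtain ⟨y, hy⟩ := hD.exists_isParent hvx hne
      refine Relation.ReflTransGen.head ((hpar x y).2 hy)
        (ih _ ?_ v y rfl (hy.2.2 v hne hvx))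
      rw [← hk]
      refine Finset.card_lt_card ((Finset.ssubset_iff_of_subset fun w hw => ?_).2 ⟨x, ?_, ?_⟩)
      · simp only [Finset.mem_filter, Finset.mem_univ, true_and] at hw ⊢
        exact hD.trans _ _ _ hw hy.2.1
      · simp [hD.refl]
      · simp only [Finset.mem_filter, Finset.mem_univ, true_and]
        exact fun hxy => hy.1 (hD.antisymm _ _ hy.2.1 hxy)
  refine ⟨par, fun v hv => ?_, ?_⟩
  · obtain ⟨c, hc, hcv⟩ := Relation.TransGen.head'_iff.1 hv
    have hparent := (hpar v c).1 hc
    exact hparent.1 (hD.antisymm _ _ hparent.2.1 (hsound _ _ hcv))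
  · funext v x
    exact propext ⟨hsound v x, hcomplete _ v x rfl⟩

/-- A forest is determined by its ancestor relation. -/
noncomputable def forestEquivAncestry (n : ℕ) : Forest n ≃ Ancestry (Fin n) :=
  Equiv.ofBijective (fun F => ⟨Descendant F.1, isAncestry_descendant F.2⟩) <| by
    constructor
    · rintro ⟨par, h⟩ ⟨par', h'⟩ heq
      have hD : Descendant par = Descendant par' := congrArg Subtype.val heq
      refine Subtype.ext (funext fun x => Option.ext fun y => ?_)
      change par x = some y ↔ par' x = some y
      rw [eq_some_iff_isParent h, eq_some_iff_isParent h', hD]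
    · rintro ⟨D, hD⟩
      obtain ⟨par, h, rfl⟩ := hD.exists_isForest
      exact ⟨⟨par, h⟩, rfl⟩

theorem forestWeight_forestEquivAncestry (F : Forest n) :
    (∀ i, (forestWeight (forestEquivAncestry n F)).1.count i = forestLeadCount F i) ∧
      (forestWeight (forestEquivAncestry n F)).2 = forestTree F := by
  classical
  have hweight : ∀ v, vertexWeight (forestEquivAncestry n F).1 v =
      ({forestInvAt F v}, if F.1 v = none then 1 else 0) := by
    intro v
    refine Prod.ext ?_ ?_
    · simp only [vertexWeight, forestInvAt, Set.ncard_eq_toFinset_card', Set.toFinset_ofPred]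
      congr 2
    · simp only [vertexWeight, eq_none_iff_forall_descendant F.2]
      congr 1
  unfold forestWeight
  simp only [hweight, Prod.fst_sum, Prod.snd_sum, Multiset.count_sum', Multiset.count_singleton]
  constructor
  · intro i
    simp [forestLeadCount, Set.ncard_eq_toFinset_card', eq_comm]
  · simp [forestTree, Set.ncard_eq_toFinset_card']

end ParentFunctions

/-! Outcomes of the parking algorithm. -/

section Outcomes

variable {n : ℕ}

theorem PA_spec (p : Fin n → ℕ) (i : Fin n) : p i ≤ PA p i ∧ ∀ j < i, PA p j ≠ PA p i := by
  have hne : {s : ℕ | p i ≤ s ∧ ∀ j : Fin n, j < i → PA p j ≠ s}.Nonempty := by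
    obtain ⟨s, hs⟩ := ((Set.finite_range (PA p)).union (Set.finite_Iio (p i))).exists_notMem
    simp only [Set.mem_union, Set.mem_range, Set.mem_Iio, not_or, not_exists, not_lt] at hs
    exact ⟨s, hs.2, fun j _ => hs.1 j⟩
  have := Nat.sInf_mem hne
  rwa [← PA] at this

theorem exists_PA_eq {p : Fin n → ℕ} {i : Fin n} {s : ℕ} (h1 : p i ≤ s) (h2 : s < PA p i) :
    ∃ j < i, PA p j = s := by
  rw [PA] at h2
  by_contra! h
  exact Nat.notMem_of_lt_sInf h2 ⟨h1, h⟩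

theorem IsParkingFunction.isParkingRecord {p : Fin n → ℕ} (h : IsParkingFunction p) :
    IsParkingRecord p (PA p) where
  one_le i := (h.1 i).1
  le i := (PA_spec p i).1
  le_card i := by simpa using h.2 i
  injective i j hij := by
    rcases lt_trichotomy i j with hlt | heq | hlt
    · exact absurd hij ((PA_spec p j).2 i hlt)
    · exact heq
    · exact absurd hij.symm ((PA_spec p i).2 j hlt)
  occupied _ _ := exists_PA_eq

theorem IsParkingRecord.eq_PA {p q : Fin n → ℕ} (h : IsParkingRecord p q) : q = PA p := by
  funext i
  induction i using WellFoundedLT.induction with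
  | _ i ih =>
  rcases lt_trichotomy (q i) (PA p i) with hlt | heq | hlt
  · obtain ⟨j, hj, hji⟩ := exists_PA_eq (h.le i) hlt
    rw [← ih j hj] at hji
    exact absurd (h.injective hji) hj.ne
  · exact heq
  · obtain ⟨j, hj, hji⟩ := h.occupied i _ (PA_spec p i).1 hlt
    rw [ih j hj] at hji
    exact absurd hji ((PA_spec p i).2 j hj)

/-- A parking function determines its outcome. -/
noncomputable def parkingFunctionEquivRecord (n : ℕ) :
    ParkingFunction n ≃ ParkingRecord (Fin n) where
  toFun P := ⟨(P.1, PA P.1), P.2.isParkingRecord⟩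
  invFun P := ⟨P.1.1, by
    have hle : ∀ i, PA P.1.1 i ≤ n := fun i => by
      rw [← P.2.eq_PA]
      simpa using P.2.le_card i
    exact ⟨fun i => ⟨P.2.one_le i, (PA_spec _ i).1.trans (hle i)⟩, hle⟩⟩
  left_inv _ := rfl
  right_inv P := Subtype.ext (Prod.ext rfl P.2.eq_PA.symm)

theorem parkingWeight_parkingFunctionEquivRecord (P : ParkingFunction n) :
    (∀ i, (parkingWeight (parkingFunctionEquivRecord n P)).1.count i = luckyCount P.1 i) ∧
      (parkingWeight (parkingFunctionEquivRecord n P)).2 = critic P.1 := by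
  classical
  have hweight : ∀ c, carWeight (parkingFunctionEquivRecord n P).1 c =
      ({jumpAt P.1 c}, if IsCritical P.1 c then 1 else 0) := by
    intro c
    simp only [carWeight, IsCritical, Fintype.card_fin]
    rfl
  unfold parkingWeight
  simp only [hweight, Prod.fst_sum, Prod.snd_sum, Multiset.count_sum', Multiset.count_singleton]
  constructor
  · intro i
    simp [luckyCount, Set.ncard_eq_toFinset_card', eq_comm]
  · simp [critic, Set.ncard_eq_toFinset_card']

end Outcomes

/-- For every `n ≥ 1` there is a bijection `φ : F_n → PF_n` such that
for every forest `F`, the type of inversions of `F` equals the type of jumps of `φ F`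
(for every `0 ≤ i ≤ n`, the number of vertices `v` with `inv(F:v) = i` equals the number
of cars `c` with `jump(φF:c) = i`), and `tree(F) = critic(φF)`. -/
theorem exists_bijection_tinv_tjump_tree_critic (n : ℕ) (hn : 1 ≤ n) :
    ∃ φ : Forest n ≃ ParkingFunction n,
      ∀ F : Forest n,
        (∀ i : ℕ, i ≤ n → forestLeadCount F i = luckyCount (φ F).1 i) ∧
        forestTree F = critic (φ F).1 := by
  obtain ⟨e, he⟩ := equidistributed_forestWeight_parkingWeight n (Fin n) (Fintype.card_fin n)
  let φ := (forestEquivAncestry n).trans (e.trans (parkingFunctionEquivRecord n).symm)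
  refine ⟨φ, fun F => ?_⟩
  have hφ : parkingWeight (parkingFunctionEquivRecord n (φ F)) =
      forestWeight (forestEquivAncestry n F) := by
    simp [φ, he]
  obtain ⟨hinv, htree⟩ := forestWeight_forestEquivAncestry F
  obtain ⟨hjump, hcritic⟩ := parkingWeight_parkingFunctionEquivRecord (φ F)
  rw [hφ] at hjump hcritic
  exact ⟨fun i _ => (hinv i).symm.trans (hjump i), htree.symm.trans hcritic⟩
end

section
/- For every natural number n ≥ 1 and every element u of a commutative ring (e.g., every real number u), Σ_{P ∈ PF_n} u^{lucky(P)} = u · Π_{i=1}^{n−1} (i + (n−i+1)·u). -/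
/-! ### The parking algorithm on a line -/

theorem PA_mem {n : ℕ} (p : Fin n → ℕ) (i : Fin n) :
    p i ≤ PA p i ∧ ∀ j : Fin n, j < i → PA p j ≠ PA p i := by
  have hne : {s : ℕ | p i ≤ s ∧ ∀ j : Fin n, j < i → PA p j ≠ s}.Nonempty := by
    obtain ⟨s, hs⟩ := (Finset.univ.image (PA p) ∪ Finset.range (p i)).exists_notMem
    simp only [Finset.mem_union, Finset.mem_image, Finset.mem_univ, true_and,
      Finset.mem_range, not_or, not_exists, not_lt] at hs
    exact ⟨s, hs.2, fun j _ => hs.1 j⟩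
  have h := Nat.sInf_mem hne
  rw [← PA] at h
  exact h

theorem exists_PA_eq_of_lt {n : ℕ} (p : Fin n → ℕ) (i : Fin n) {s : ℕ}
    (hs : p i ≤ s) (hlt : s < PA p i) : ∃ j < i, PA p j = s := by
  rw [PA] at hlt
  have h := Nat.notMem_of_lt_sInf hlt
  simpa [hs] using h

/-! ### The parking algorithm on a circle -/

/-- Parking on the circle `ZMod N`: car `i` drives to `p i` and then moves forward, cyclically,
to the first space not occupied by an earlier car. -/
noncomputable def circPark {N m : ℕ} (p : Fin m → ZMod N) (i : Fin m) : ZMod N :=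
  p i + ((sInf {k : ℕ | ∀ j : Fin m, j < i → circPark p j ≠ p i + (k : ZMod N)} : ℕ) : ZMod N)
termination_by i.val
decreasing_by exact ‹_ < _›

/-- The number of cars that park in their favorite space on the circle. -/
noncomputable def circLucky {N m : ℕ} (p : Fin m → ZMod N) : ℕ :=
  (Finset.univ.filter fun i => circPark p i = p i).card

section Circle

variable {N m : ℕ}

theorem circPark_eq (p : Fin m → ZMod N) (i : Fin m) (k : ℕ)
    (hk : ∀ j < i, circPark p j ≠ p i + (k : ZMod N))
    (hlt : ∀ l < k, ∃ j < i, circPark p j = p i + (l : ZMod N)) :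
    circPark p i = p i + (k : ZMod N) := by
  rw [circPark]
  congr 2
  refine le_antisymm (Nat.sInf_le hk) (le_csInf ⟨k, hk⟩ fun l hl => ?_)
  by_contra! h
  obtain ⟨j, hj, e⟩ := hlt l h
  exact hl j hj e

theorem circPark_ne [NeZero N] (hm : m ≤ N) (p : Fin m → ZMod N) {i j : Fin m} (hj : j < i) :
    circPark p j ≠ circPark p i := by
  have hne : {k : ℕ | ∀ j : Fin m, j < i → circPark p j ≠ p i + (k : ZMod N)}.Nonempty := by
    have hcard : ((Finset.Iio i).image (circPark p)).card <
        (Finset.univ : Finset (ZMod N)).card := by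
      refine Finset.card_image_le.trans_lt ?_
      rw [Fin.card_Iio, Finset.card_univ, ZMod.card]
      omega
    obtain ⟨g, -, hg⟩ := Finset.exists_mem_notMem_of_card_lt_card hcard
    refine ⟨(g - p i).val, fun j hj e => hg ?_⟩
    rw [ZMod.natCast_zmod_val, add_sub_cancel] at e
    exact Finset.mem_image.2 ⟨j, Finset.mem_Iio.2 hj, e⟩
  have h := Nat.sInf_mem hne j hj
  rwa [← circPark] at h

theorem circPark_injective [NeZero N] (hm : m ≤ N) (p : Fin m → ZMod N) :
    Function.Injective (circPark p) := by
  intro i j h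
  rcases lt_trichotomy i j with hij | hij | hij
  · exact absurd h (circPark_ne hm p hij)
  · exact hij
  · exact absurd h.symm (circPark_ne hm p hij)

theorem circPark_eq_self_iff [NeZero N] (hm : m ≤ N) (p : Fin m → ZMod N) (i : Fin m) :
    circPark p i = p i ↔ ∀ j < i, circPark p j ≠ p i := by
  constructor
  · intro h j hj e
    exact circPark_ne hm p hj (e.trans h.symm)
  · intro h
    simpa using circPark_eq p i 0 (by simpa using h) (by simp)

theorem circPark_snoc_castSucc (p : Fin m → ZMod N) (a : ZMod N) (i : Fin m) :
    circPark (Fin.snoc p a : Fin (m + 1) → ZMod N) i.castSucc = circPark p i := by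
  induction i using WellFoundedLT.induction with
  | ind i ih =>
    rw [circPark, circPark, Fin.snoc_castSucc]
    congr 4
    ext k
    constructor
    · intro h j hj
      rw [← ih j hj]
      exact h _ (Fin.castSucc_lt_castSucc_iff.2 hj)
    · intro h j hj
      obtain ⟨j, rfl⟩ := Fin.exists_castSucc_eq.2 (Fin.ne_last_of_lt hj)
      rw [Fin.castSucc_lt_castSucc_iff] at hj
      rw [ih j hj]
      exact h j hj

theorem circLucky_snoc [NeZero N] (hm : m + 1 ≤ N) (p : Fin m → ZMod N) (a : ZMod N) :
    circLucky (Fin.snoc p a : Fin (m + 1) → ZMod N) =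
      circLucky p + if a ∈ Finset.univ.image (circPark p) then 0 else 1 := by
  have hlast : circPark (Fin.snoc p a : Fin (m + 1) → ZMod N) (Fin.last m) = a ↔
      a ∉ Finset.univ.image (circPark p) := by
    have h := circPark_eq_self_iff hm (Fin.snoc p a : Fin (m + 1) → ZMod N) (Fin.last m)
    rw [Fin.snoc_last] at h
    rw [h]
    simp only [Finset.mem_image, Finset.mem_univ, true_and, not_exists]
    constructor
    · intro h j
      rw [← circPark_snoc_castSucc p a j]
      exact h _ (Fin.castSucc_lt_last j)
    · intro h j hj
      obtain ⟨j, rfl⟩ := Fin.exists_castSucc_eq.2 (Fin.ne_last_of_lt hj)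
      rw [circPark_snoc_castSucc]
      exact h j
  unfold circLucky
  rw [Finset.card_filter, Finset.card_filter, Fin.sum_univ_castSucc]
  simp only [circPark_snoc_castSucc, Fin.snoc_castSucc, Fin.snoc_last, hlast, ite_not]

theorem sum_pow_circLucky [NeZero N] {R : Type*} [CommRing R] (u : R) (hm : m ≤ N) :
    ∑ p : Fin m → ZMod N, u ^ circLucky p =
      ∏ i ∈ Finset.range m, ((i : R) + ((N - i : ℕ) : R) * u) := by
  induction m with
  | zero => simp [circLucky]
  | succ m ih =>
    rw [Finset.prod_range_succ, ← ih (by omega), Finset.sum_mul,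
      ← (Fin.snocEquiv fun _ => ZMod N).sum_comp, Fintype.sum_prod_type_right]
    refine Finset.sum_congr rfl fun p _ => ?_
    have hcard : (Finset.univ.image (circPark p)).card = m := by
      rw [Finset.card_image_of_injective _ (circPark_injective (by omega) p), Finset.card_fin]
    have hfac : ∀ a : ZMod N, u ^ circLucky (Fin.snocEquiv (fun _ => ZMod N) (a, p)) =
        u ^ circLucky p * if a ∈ Finset.univ.image (circPark p) then 1 else u := by
      intro a
      change u ^ circLucky (Fin.snoc p a : Fin (m + 1) → ZMod N) = _
      rw [circLucky_snoc hm, pow_add]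
      split_ifs <;> simp
    simp only [hfac]
    rw [← Finset.mul_sum, Finset.sum_ite, Finset.filter_mem_eq_inter, Finset.univ_inter,
      Finset.sum_const, Finset.sum_const, hcard, Finset.filter_notMem_eq_sdiff,
      ← Finset.compl_eq_univ_sdiff, Finset.card_compl, hcard, ZMod.card]
    simp

theorem circPark_add_const (p : Fin m → ZMod N) (g : ZMod N) (i : Fin m) :
    circPark (fun j => p j + g) i = circPark p i + g := by
  induction i using WellFoundedLT.induction with
  | ind i ih =>
    rw [circPark, circPark, add_right_comm]
    congr 4
    ext k
    refine forall₂_congr fun j hj => ?_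
    rw [ih j hj, add_right_comm, Ne, add_left_inj]

theorem circLucky_add_const (p : Fin m → ZMod N) (g : ZMod N) :
    circLucky (fun j => p j + g) = circLucky p := by
  simp only [circLucky, circPark_add_const, add_left_inj]

open Classical in
/-- By rotational symmetry, each space of the circle `ZMod (n + 1)` is the one left empty by `n`
cars equally often. -/
theorem sum_pow_circLucky_eq_mul {n : ℕ} {R : Type*} [CommRing R] (u : R) :
    ∑ p : Fin n → ZMod (n + 1), u ^ circLucky p =
      ((n + 1 : ℕ) : R) * ∑ p : Fin n → ZMod (n + 1) with (∀ i, circPark p i ≠ 0),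
        u ^ circLucky p := by
  have hone (p : Fin n → ZMod (n + 1)) :
      ∑ g : ZMod (n + 1), (if ∀ i, circPark p i ≠ g then u ^ circLucky p else 0) =
        u ^ circLucky p := by
    have hcompl : (Finset.univ.filter fun g => ∀ i, circPark p i ≠ g) =
        (Finset.univ.image (circPark p))ᶜ := by
      ext g; simp
    rw [← Finset.sum_filter, Finset.sum_const, hcompl, Finset.card_compl,
      Finset.card_image_of_injective _ (circPark_injective (by omega) p), ZMod.card,
      Finset.card_fin]
    simp
  have hrot (g : ZMod (n + 1)) :
      ∑ p : Fin n → ZMod (n + 1), (if ∀ i, circPark p i ≠ g then u ^ circLucky p else 0) =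
        ∑ p : Fin n → ZMod (n + 1), (if ∀ i, circPark p i ≠ 0 then u ^ circLucky p else 0) := by
    rw [← Equiv.sum_comp (Equiv.addRight (fun _ : Fin n => g))]
    refine Finset.sum_congr rfl fun p _ => ?_
    have hp : Equiv.addRight (fun _ : Fin n => g) p = fun j => p j + g := rfl
    simp only [hp, circPark_add_const, circLucky_add_const, ne_eq, add_eq_right]
  rw [← Finset.sum_congr rfl fun p _ => hone p, Finset.sum_comm,
    Finset.sum_congr rfl fun g _ => hrot g, Finset.sum_const, Finset.card_univ, ZMod.card,
    nsmul_eq_mul, Finset.sum_filter]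

end Circle

/-! ### Comparison of the two algorithms -/

theorem ZMod.natCast_inj_of_le {n a b : ℕ} (ha : a ≤ n) (hb : b ≤ n)
    (h : (a : ZMod (n + 1)) = b) : a = b := by
  have h' := congrArg ZMod.val h
  rwa [ZMod.val_natCast_of_lt (by omega), ZMod.val_natCast_of_lt (by omega)] at h'

section Comparison

variable {n : ℕ} (p : Fin n → ℕ)

theorem circPark_natCast (i : Fin n) (h : ∀ j ≤ i, PA p j ≤ n) :
    circPark (fun j => (p j : ZMod (n + 1))) i = (PA p i : ZMod (n + 1)) := by
  induction i using WellFoundedLT.induction with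
  | ind i ih =>
    have ih' : ∀ j < i, circPark (fun j => (p j : ZMod (n + 1))) j = (PA p j : ZMod (n + 1)) :=
      fun j hj => ih j hj fun l hl => h l (hl.trans hj.le)
    obtain ⟨hle, hne⟩ := PA_mem p i
    have hk : PA p i = p i + (PA p i - p i) := by omega
    rw [circPark_eq _ i (PA p i - p i)]
    · rw [← Nat.cast_add, ← hk]
    · intro j hj e
      rw [ih' j hj, ← Nat.cast_add, ← hk] at e
      exact hne j hj (ZMod.natCast_inj_of_le (h j hj.le) (h i le_rfl) e)
    · intro l hl
      obtain ⟨j, hj, e⟩ := exists_PA_eq_of_lt p i (s := p i + l) (by omega) (by omega)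
      exact ⟨j, hj, by rw [ih' j hj, e, Nat.cast_add]⟩

theorem PA_le_of_circPark_ne_zero (hp : ∀ i, 1 ≤ p i ∧ p i ≤ n)
    (h : ∀ i, circPark (fun j => (p j : ZMod (n + 1))) i ≠ 0) (i : Fin n) : PA p i ≤ n := by
  induction i using WellFoundedLT.induction with
  | ind i ih =>
    have ih' : ∀ j < i, circPark (fun j => (p j : ZMod (n + 1))) j = (PA p j : ZMod (n + 1)) :=
      fun j hj => circPark_natCast p j fun l hl => ih l (hl.trans_lt hj)
    by_contra! hlt
    have hle := (hp i).2
    have hzero : (p i : ZMod (n + 1)) + ((n + 1 - p i : ℕ) : ZMod (n + 1)) = 0 := by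
      rw [← Nat.cast_add, show p i + (n + 1 - p i) = n + 1 by omega, ZMod.natCast_self]
    refine h i ((circPark_eq _ i (n + 1 - p i) ?_ ?_).trans hzero)
    · intro j _
      rw [hzero]
      exact h j
    · intro l hl
      obtain ⟨j, hj, e⟩ := exists_PA_eq_of_lt p i (s := p i + l) (by omega) (by omega)
      exact ⟨j, hj, by rw [ih' j hj, e, Nat.cast_add]⟩

variable {p}

theorem IsParkingFunction.circPark_ne_zero (hp : IsParkingFunction p) (i : Fin n) :
    circPark (fun j => (p j : ZMod (n + 1))) i ≠ 0 := by
  rw [circPark_natCast p i fun j _ => hp.2 j]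
  intro h
  have h0 := ZMod.natCast_inj_of_le (hp.2 i) (Nat.zero_le n) (by simpa using h)
  have := (PA_mem p i).1
  have := (hp.1 i).1
  omega

theorem IsParkingFunction.circLucky_natCast (hp : IsParkingFunction p) :
    circLucky (fun j => (p j : ZMod (n + 1))) = lucky p := by
  rw [circLucky, lucky, ← Set.ncard_coe_finset]
  congr 1
  ext i
  have hle := (PA_mem p i).1
  simp only [Finset.coe_filter, Finset.mem_univ, true_and, Set.mem_ofPred_eq, jumpAt,
    circPark_natCast p i fun j _ => hp.2 j]
  constructor
  · intro h
    rw [ZMod.natCast_inj_of_le (hp.2 i) (hp.1 i).2 h, Nat.sub_self]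
  · intro h
    rw [show PA p i = p i by omega]

end Comparison

open Classical in
theorem sum_pow_lucky_eq_sum_pow_circLucky (n : ℕ) {R : Type*} [CommRing R] (u : R) :
    ∑ P : ParkingFunction n, u ^ lucky P.1 =
      ∑ p : Fin n → ZMod (n + 1) with (∀ i, circPark p i ≠ 0), u ^ circLucky p := by
  refine Finset.sum_bij (fun P _ => fun j => (P.1 j : ZMod (n + 1))) ?_ ?_ ?_ ?_
  · intro P _
    exact Finset.mem_filter.2 ⟨Finset.mem_univ _, P.2.circPark_ne_zero⟩
  · intro P _ Q _ h
    refine Subtype.ext (funext fun i => ?_)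
    exact ZMod.natCast_inj_of_le (P.2.1 i).2 (Q.2.1 i).2 (congrFun h i)
  · intro p hp
    have hne := (Finset.mem_filter.1 hp).2
    have hcast : (fun j => ((p j).val : ZMod (n + 1))) = p :=
      funext fun j => ZMod.natCast_zmod_val (p j)
    have hbound : ∀ i, 1 ≤ (p i).val ∧ (p i).val ≤ n := by
      refine fun i => ⟨Nat.one_le_iff_ne_zero.2 fun h0 => hne i ?_,
        Nat.lt_succ_iff.1 (ZMod.val_lt (p i))⟩
      rw [ZMod.val_eq_zero] at h0
      rw [← h0, circPark_eq_self_iff (by omega), h0]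
      exact fun j _ => hne j
    exact ⟨⟨fun i => (p i).val, hbound, PA_le_of_circPark_ne_zero _ hbound (by rwa [hcast])⟩,
      Finset.mem_univ _, hcast⟩
  · intro P _
    rw [P.2.circLucky_natCast]

open Polynomial in
/-- Gessel–Seo formula:
`Σ_{P ∈ PF_n} u^{lucky P} = u · Π_{i=1}^{n-1} (i + (n-i+1)·u)`. -/
theorem sum_lucky_eq_prod (n : ℕ) (hn : 1 ≤ n) (R : Type*) [CommRing R] (u : R) :
    ∑ P : ParkingFunction n, u ^ lucky P.1
      = u * ∏ i ∈ Finset.Icc 1 (n - 1), ((i : R) + ((n - i + 1 : ℕ) : R) * u) := by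
  have hX : ∑ P : ParkingFunction n, (X : ℤ[X]) ^ lucky P.1 =
      X * ∏ i ∈ Finset.Icc 1 (n - 1), ((i : ℤ[X]) + ((n - i + 1 : ℕ) : ℤ[X]) * X) := by
    have h0 : ((n + 1 : ℕ) : ℤ[X]) ≠ 0 := Nat.cast_ne_zero.2 n.succ_ne_zero
    apply mul_left_cancel₀ h0
    rw [sum_pow_lucky_eq_sum_pow_circLucky, ← sum_pow_circLucky_eq_mul,
      sum_pow_circLucky X n.le_succ, Finset.range_eq_Ico, Finset.prod_eq_prod_Ico_succ_bot hn,
      ← Finset.Ico_succ_right_eq_Icc, Nat.succ_eq_succ,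
      Nat.succ_eq_add_one (n - 1), Nat.sub_add_cancel hn]
    simp only [Nat.cast_zero, zero_add, Nat.sub_zero, mul_assoc]
    congr 2
    refine Finset.prod_congr rfl fun i hi => ?_
    rw [Nat.succ_sub (Finset.mem_Ico.1 hi).2.le]
  simpa using congrArg (aeval u) hX
end
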